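/- Let n be a positive integer, let (S₁,ᵢ, S₂,ᵢ), i = 1,...,n, be i.i.d. pairs of random variables with values in finite sets, and let T₂ = f(S₂,₁,...,S₂,ₙ) for some function f into a finite set. Then H(T₂) ≥ Σ_{i=1}^n I( S₂,ᵢ ; (T₂, S₂^{i−1}) | S₁,ᵢ ). -/

import Mathlib

open scoped Classical

/-- The probability of the event `f = a` under the pmf `P` on a finite space. -/
noncomputable def pr {Ω A : Type*} [Fintype Ω] (P : Ω → ℝ) (f : Ω → A) (a : A) : ℝ :=
  ∑ ω, if f ω = a then P ω else 0

/-- Shannon entropy `H(f)` (convention `0 log 0 = 0`, automatic since `Real.log 0 = 0`). -/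
noncomputable def ent {Ω A : Type*} [Fintype Ω] [Fintype A] (P : Ω → ℝ) (f : Ω → A) : ℝ :=
  -∑ a, pr P f a * Real.log (pr P f a)

/-- Mutual information `I(f;g) = H(f) + H(g) − H(f,g)`. -/
noncomputable def mi {Ω A B : Type*} [Fintype Ω] [Fintype A] [Fintype B]
    (P : Ω → ℝ) (f : Ω → A) (g : Ω → B) : ℝ :=
  ent P f + ent P g - ent P (fun ω => (f ω, g ω))

/-- Conditional mutual information `I(f;g|h) = H(f,h) + H(g,h) − H(f,g,h) − H(h)`. -/
noncomputable def cmi {Ω A B C : Type*} [Fintype Ω] [Fintype A] [Fintype B] [Fintype C]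
    (P : Ω → ℝ) (f : Ω → A) (g : Ω → B) (h : Ω → C) : ℝ :=
  ent P (fun ω => (f ω, h ω)) + ent P (fun ω => (g ω, h ω)) -
    ent P (fun ω => (f ω, g ω, h ω)) - ent P h

/-- The prefix tuple `A^{i-1} = (A₁, …, A_{i−1})` of a finite sequence of random
variables (as a single random variable). -/
def pre {Ω A : Type*} {n : ℕ} (f : Fin n → Ω → A) (i : Fin n) :
    Ω → (Fin i.val → A) :=
  fun ω j => f ⟨j.val, j.isLt.trans i.isLt⟩ ω

/-- The suffix tuple `A_{i+1}^n = (A_{i+1}, …, A_n)` of a finite sequence of random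
variables (as a single random variable). -/
def suf {Ω A : Type*} {n : ℕ} (f : Fin n → Ω → A) (i : Fin n) :
    Ω → (Fin (n - (i.val + 1)) → A) :=
  fun ω j => f ⟨i.val + 1 + j.val, by have h1 := j.isLt; have h2 := i.isLt; omega⟩ ω

section Entropy

variable {Ω α β γ δ : Type*} [Fintype Ω] {P : Ω → ℝ}

theorem sum_pr_mul [Fintype α] (P : Ω → ℝ) (X : Ω → α) (g : α → ℝ) :
    ∑ a, pr P X a * g a = ∑ ω, P ω * g (X ω) := by
  simp only [pr, Finset.sum_mul, ite_mul, zero_mul]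
  rw [Finset.sum_comm]
  exact Finset.sum_congr rfl fun ω _ => by simp

theorem sum_pr [Fintype α] (P : Ω → ℝ) (X : Ω → α) : ∑ a, pr P X a = ∑ ω, P ω := by
  simpa using sum_pr_mul P X fun _ => 1

theorem pr_nonneg (hP : ∀ ω, 0 ≤ P ω) (X : Ω → α) (a : α) : 0 ≤ pr P X a :=
  Finset.sum_nonneg fun ω _ => by split_ifs <;> simp [hP]

theorem pr_apply_pos (hP : ∀ ω, 0 ≤ P ω) (X : Ω → α) {ω : Ω} (h : 0 < P ω) :
    0 < pr P X (X ω) := by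
  refine Finset.sum_pos' (fun ω' _ => ?_) ⟨ω, Finset.mem_univ _, by simpa using h⟩
  split_ifs <;> simp [hP]

theorem pr_comp [Fintype α] (P : Ω → ℝ) (X : Ω → α) (φ : α → β) (b : β) :
    pr P (fun ω => φ (X ω)) b = ∑ a, if φ a = b then pr P X a else 0 := by
  have h := sum_pr_mul P X fun a => if φ a = b then 1 else 0
  simp only [mul_ite, mul_one, mul_zero] at h
  exact h.symm

/-- Entropy as the expectation of the information content. -/
theorem ent_eq_sum [Fintype α] (P : Ω → ℝ) (X : Ω → α) :
    ent P X = -∑ ω, P ω * Real.log (pr P X (X ω)) := by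
  rw [ent, sum_pr_mul P X fun a => Real.log (pr P X a)]

/-- Entropy depends only on the partition induced by the random variable. -/
theorem ent_congr [Fintype α] [Fintype β] (P : Ω → ℝ) {X : Ω → α} {Y : Ω → β}
    (h : ∀ ω ω', X ω = X ω' ↔ Y ω = Y ω') : ent P X = ent P Y := by
  simp only [ent_eq_sum, pr, h]

theorem ent_prod_le [Fintype α] [Fintype β] (hP : ∀ ω, 0 ≤ P ω) (hP1 : ∑ ω, P ω = 1)
    (X : Ω → α) (Y : Ω → β) : ent P (fun ω => (X ω, Y ω)) ≤ ent P X + ent P Y := by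
  set Z : Ω → α × β := fun ω => (X ω, Y ω)
  let r : α × β → ℝ := fun z => pr P X z.1 * pr P Y z.2 / pr P Z z
  have ratio_sum_le : ∑ ω, P ω * r (Z ω) ≤ 1 := by
    rw [← sum_pr_mul P Z r]
    calc ∑ z, pr P Z z * r z ≤ ∑ z : α × β, pr P X z.1 * pr P Y z.2 := by
          refine Finset.sum_le_sum fun z _ => ?_
          rcases eq_or_ne (pr P Z z) 0 with h | h
          · rw [h, zero_mul]
            exact mul_nonneg (pr_nonneg hP _ _) (pr_nonneg hP _ _)
          · exact (mul_div_cancel₀ _ h).le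
      _ = 1 := by
          rw [Fintype.sum_prod_type]
          simp only [← Finset.mul_sum, sum_pr, hP1, mul_one]
  have log_le : ∀ ω, P ω * (Real.log (pr P X (X ω)) + Real.log (pr P Y (Y ω)) -
      Real.log (pr P Z (Z ω))) ≤ P ω * r (Z ω) - P ω := by
    intro ω
    rcases (hP ω).eq_or_lt with h | h
    · simp [← h]
    · have hX := pr_apply_pos hP X h
      have hY := pr_apply_pos hP Y h
      have hZ := pr_apply_pos hP Z h
      rw [← Real.log_mul hX.ne' hY.ne', ← Real.log_div (mul_pos hX hY).ne' hZ.ne']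
      have := Real.log_le_sub_one_of_pos (div_pos (mul_pos hX hY) hZ)
      calc _ ≤ P ω * (r (Z ω) - 1) := mul_le_mul_of_nonneg_left this h.le
        _ = _ := by ring
  have key := Finset.sum_le_sum fun ω (_ : ω ∈ Finset.univ) => log_le ω
  simp only [mul_sub, mul_add, Finset.sum_sub_distrib, Finset.sum_add_distrib, hP1] at key
  rw [ent_eq_sum, ent_eq_sum, ent_eq_sum]
  linarith

/-- If `X` and `Y` are conditionally independent given `φ(Y)`, then so are `X` and `ψ(Y)`,
in the form of an entropy identity. -/
theorem ent_add_ent_of_markov [Fintype α] [Fintype β] [Fintype γ] [Fintype δ]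
    (hP : ∀ ω, 0 ≤ P ω) (X : Ω → α) (Y : Ω → β) (φ : β → γ) (ψ : β → δ)
    (h : ∀ a y, pr P (fun ω => (X ω, Y ω)) (a, y) * pr P (fun ω => φ (Y ω)) (φ y) =
      pr P Y y * pr P (fun ω => (X ω, φ (Y ω))) (a, φ y)) :
    ent P (fun ω => (φ (Y ω), ψ (Y ω), X ω)) + ent P (fun ω => φ (Y ω)) =
      ent P (fun ω => (φ (Y ω), ψ (Y ω))) + ent P (fun ω => (X ω, φ (Y ω))) := by
  have factor : ∀ a b w, pr P (fun ω => (φ (Y ω), ψ (Y ω), X ω)) (b, w, a) *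
      pr P (fun ω => φ (Y ω)) b =
      pr P (fun ω => (φ (Y ω), ψ (Y ω))) (b, w) * pr P (fun ω => (X ω, φ (Y ω))) (a, b) := by
    intro a b w
    rw [pr_comp P (fun ω => (X ω, Y ω)) (fun z => (φ z.2, ψ z.2, z.1)) (b, w, a),
      pr_comp P Y (fun y => (φ y, ψ y)) (b, w), Fintype.sum_prod_type, Finset.sum_comm,
      Finset.sum_mul, Finset.sum_mul]
    refine Finset.sum_congr rfl fun y _ => ?_
    by_cases hy : φ y = b ∧ ψ y = w
    · obtain ⟨rfl, rfl⟩ := hy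
      simpa using h a y
    · have h1 : ∀ x : α, ¬ ((φ y, ψ y, x) = (b, w, a)) := fun x hx => hy (by simp_all)
      have h2 : ¬ ((φ y, ψ y) = (b, w)) := fun hx => hy (by simp_all)
      simp [h1, h2]
  simp only [ent_eq_sum, ← neg_add, ← Finset.sum_add_distrib, ← mul_add]
  congr 1
  refine Finset.sum_congr rfl fun ω _ => ?_
  rcases (hP ω).eq_or_lt with h0 | h0
  · simp [← h0]
  · rw [← Real.log_mul (pr_apply_pos hP (fun ω => (φ (Y ω), ψ (Y ω), X ω)) h0).ne'
        (pr_apply_pos hP (fun ω => φ (Y ω)) h0).ne',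
      ← Real.log_mul (pr_apply_pos hP (fun ω => (φ (Y ω), ψ (Y ω))) h0).ne'
        (pr_apply_pos hP (fun ω => (X ω, φ (Y ω))) h0).ne', factor]

end Entropy

section ProductLaw

variable {Ω α β : Type*} [Fintype Ω] [Fintype α] [Fintype β] {n : ℕ} {P : Ω → ℝ}
  {X : Fin n → Ω → α} {Y : Fin n → Ω → β} {μ : α → β → ℝ}

theorem sum_mul_prod_of_iid
    (hiid : ∀ (a : Fin n → α) (b : Fin n → β),
      pr P (fun ω => ((fun i => X i ω), (fun i => Y i ω))) (a, b) = ∏ i, μ (a i) (b i))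
    (g : Fin n → α → β → ℝ) :
    ∑ ω, P ω * ∏ i, g i (X i ω) (Y i ω) = ∏ i, ∑ a, ∑ b, μ a b * g i a b := by
  have h := sum_pr_mul P (fun ω => ((fun i => X i ω), (fun i => Y i ω)))
    fun z => ∏ i, g i (z.1 i) (z.2 i)
  rw [← h, Fintype.sum_prod_type]
  simp only [hiid, ← Finset.prod_mul_distrib]
  simp only [Finset.prod_univ_sum, Fintype.piFinset_univ]

theorem pr_eq_prod_of_iid
    (hiid : ∀ (a : Fin n → α) (b : Fin n → β),
      pr P (fun ω => ((fun i => X i ω), (fun i => Y i ω))) (a, b) = ∏ i, μ (a i) (b i))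
    (b : Fin n → β) : pr P (fun ω i => Y i ω) b = ∏ i, ∑ a, μ a (b i) := by
  have h := sum_mul_prod_of_iid hiid fun i _ y => if y = b i then 1 else 0
  simpa [pr, funext_iff, Finset.prod_ite_zero] using h

theorem pr_pair_of_iid (hμ1 : ∑ a, ∑ b, μ a b = 1)
    (hiid : ∀ (a : Fin n → α) (b : Fin n → β),
      pr P (fun ω => ((fun i => X i ω), (fun i => Y i ω))) (a, b) = ∏ i, μ (a i) (b i))
    (i : Fin n) (a : α) (b : β) : pr P (fun ω => (X i ω, Y i ω)) (a, b) = μ a b := by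
  have h := sum_mul_prod_of_iid hiid fun j x y =>
    if j = i then if (x, y) = (a, b) then 1 else 0 else 1
  have hfac : ∀ j, (∑ x, ∑ y, μ x y * if j = i then if (x, y) = (a, b) then 1 else 0 else 1) =
      if j = i then μ a b else 1 := by
    intro j
    split_ifs
    · simp [ite_and]
    · simpa using hμ1
  simp only [hfac, Finset.prod_ite_eq', Finset.mem_univ, if_true] at h
  simpa [pr] using h

theorem pr_snd_of_iid (hμ1 : ∑ a, ∑ b, μ a b = 1)
    (hiid : ∀ (a : Fin n → α) (b : Fin n → β),
      pr P (fun ω => ((fun i => X i ω), (fun i => Y i ω))) (a, b) = ∏ i, μ (a i) (b i))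
    (i : Fin n) (b : β) : pr P (Y i) b = ∑ a, μ a b := by
  rw [pr_comp P (fun ω => (X i ω, Y i ω)) Prod.snd b, Fintype.sum_prod_type]
  simp [pr_pair_of_iid hμ1 hiid]

theorem pr_fst_snd_of_iid
    (hiid : ∀ (a : Fin n → α) (b : Fin n → β),
      pr P (fun ω => ((fun i => X i ω), (fun i => Y i ω))) (a, b) = ∏ i, μ (a i) (b i))
    (i : Fin n) (a : α) (b : Fin n → β) :
    pr P (fun ω => (X i ω, fun j => Y j ω)) (a, b) =
      μ a (b i) * ∏ j ∈ Finset.univ.erase i, ∑ x, μ x (b j) := by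
  have h := sum_mul_prod_of_iid hiid fun j x y =>
    if (j = i → x = a) ∧ y = b j then 1 else 0
  have hind : ∀ ω, (∏ j, if (j = i → X j ω = a) ∧ Y j ω = b j then (1 : ℝ) else 0) =
      if (X i ω, fun j => Y j ω) = (a, b) then 1 else 0 := by
    intro ω
    simp [Finset.prod_ite_zero, forall_and, funext_iff]
  have hfac : ∀ j, (∑ x, ∑ y, μ x y * if (j = i → x = a) ∧ y = b j then 1 else 0) =
      if j = i then μ a (b i) else ∑ x, μ x (b j) := by
    intro j
    split_ifs with hj
    · subst hj
      simp [ite_and]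
    · simp [hj]
  simp only [hind, hfac] at h
  simp only [mul_ite, mul_one, mul_zero] at h
  rw [← Finset.mul_prod_erase _ _ (Finset.mem_univ i), if_pos rfl] at h
  refine Eq.trans (by simp only [pr]; congr!) (h.trans ?_)
  congr 1
  exact Finset.prod_congr rfl fun j hj => if_neg (Finset.ne_of_mem_erase hj)

theorem ent_pi_of_iid (hP : ∀ ω, 0 ≤ P ω) (hμ1 : ∑ a, ∑ b, μ a b = 1)
    (hiid : ∀ (a : Fin n → α) (b : Fin n → β),
      pr P (fun ω => ((fun i => X i ω), (fun i => Y i ω))) (a, b) = ∏ i, μ (a i) (b i)) :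
    ent P (fun ω i => Y i ω) = ∑ i, ent P (Y i) := by
  simp only [ent_eq_sum, Finset.sum_neg_distrib]
  rw [Finset.sum_comm]
  congr 1
  refine Finset.sum_congr rfl fun ω _ => ?_
  rw [← Finset.mul_sum]
  rcases (hP ω).eq_or_lt with h0 | h0
  · simp [← h0]
  · rw [← Real.log_prod fun i _ => (pr_apply_pos hP (Y i) h0).ne', pr_eq_prod_of_iid hiid]
    simp only [pr_snd_of_iid hμ1 hiid]

end ProductLaw

/-- if `(S₁,ᵢ, S₂,ᵢ)`, `i = 1,…,n`, are i.i.d. pairs with common pmf `μ`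
and `T₂ = f(S₂,₁, …, S₂,ₙ)`, then `H(T₂) ≥ Σᵢ I(S₂,ᵢ ; T₂, S₂^{i−1} | S₁,ᵢ)`. -/
theorem case2C_side_rate {Ω A1 A2 Tt : Type*}
    [Fintype Ω] [Fintype A1] [Fintype A2] [Fintype Tt]
    {n : ℕ} (hn : 0 < n)
    (P : Ω → ℝ) (hP0 : ∀ ω, 0 ≤ P ω) (hP1 : ∑ ω, P ω = 1)
    (S1 : Fin n → Ω → A1) (S2 : Fin n → Ω → A2)
    (μ : A1 → A2 → ℝ) (hμ0 : ∀ a b, 0 ≤ μ a b) (hμ1 : ∑ a, ∑ b, μ a b = 1)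
    (hiid : ∀ (a : Fin n → A1) (b : Fin n → A2),
      pr P (fun ω => ((fun i => S1 i ω), (fun i => S2 i ω))) (a, b) =
        ∏ i, μ (a i) (b i))
    (f : (Fin n → A2) → Tt) (T2 : Ω → Tt)
    (hT2 : ∀ ω, T2 ω = f (fun i => S2 i ω)) :
    ∑ i : Fin n, cmi P (S2 i) (fun ω => (T2 ω, pre S2 i ω)) (S1 i) ≤ ent P T2 := by
  let Y : Ω → Fin n → A2 := fun ω i => S2 i ω
  let h : ℕ → ℝ := fun k =>
    ent P fun ω => (T2 ω, fun j : Fin n => if j.val < k then some (S2 j ω) else none)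
  have cmi_le : ∀ i : Fin n, cmi P (S2 i) (fun ω => (T2 ω, pre S2 i ω)) (S1 i) ≤
      (h i - h (i + 1)) + ent P (S2 i) := by
    intro i
    have markov := ent_add_ent_of_markov hP0 (S1 i) Y (fun y => y i)
      (fun y => (f y, fun j : Fin i.val => y ⟨j.val, j.isLt.trans i.isLt⟩)) (by
        intro a y
        have hY : pr P Y y = _ := pr_eq_prod_of_iid hiid y
        rw [pr_fst_snd_of_iid hiid, hY, pr_snd_of_iid hμ1 hiid, pr_pair_of_iid hμ1 hiid,
          ← Finset.mul_prod_erase _ _ (Finset.mem_univ i)]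
        ring)
    have hW : ent P (fun ω => (T2 ω, pre S2 i ω)) = h i := by
      refine ent_congr P fun ω ω' => ?_
      simp only [Prod.mk.injEq, pre, funext_iff]
      refine and_congr_right fun _ => ⟨fun H j => ?_, fun H j => ?_⟩
      · split_ifs with hj
        · rw [H ⟨j.val, hj⟩]
        · rfl
      · simpa using H ⟨j.val, j.isLt.trans i.isLt⟩
    have hBW : ent P (fun ω => (S2 i ω, T2 ω, pre S2 i ω)) = h (i + 1) := by
      refine ent_congr P fun ω ω' => ?_
      simp only [Prod.mk.injEq, pre, funext_iff]
      refine ⟨fun ⟨H1, H2, H⟩ => ⟨H2, fun j => ?_⟩, fun ⟨H2, H⟩ => ⟨?_, H2, fun j => ?_⟩⟩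
      · split_ifs with hj
        · rcases (Nat.lt_succ_iff.mp hj).eq_or_lt with e | e
          · rw [Fin.ext e, H1]
          · rw [H ⟨j.val, e⟩]
        · rfl
      · simpa using H i
      · simpa [j.isLt.trans (Nat.lt_succ_self _)] using H ⟨j.val, j.isLt.trans i.isLt⟩
    have hBWA : ent P (fun ω => (S2 i ω, (T2 ω, pre S2 i ω), S1 i ω)) =
        ent P (fun ω => (Y ω i, (f (Y ω), fun j : Fin i.val =>
          Y ω ⟨j.val, j.isLt.trans i.isLt⟩), S1 i ω)) := by
      simp only [hT2]; rfl
    have hBW' : ent P (fun ω => (S2 i ω, T2 ω, pre S2 i ω)) =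
        ent P (fun ω => (Y ω i, f (Y ω), fun j : Fin i.val =>
          Y ω ⟨j.val, j.isLt.trans i.isLt⟩)) := by
      simp only [hT2]; rfl
    have hB : ent P (fun ω => Y ω i) = ent P (S2 i) := rfl
    have hAB : ent P (fun ω => (S2 i ω, S1 i ω)) = ent P (fun ω => (S1 i ω, Y ω i)) :=
      ent_congr P fun ω ω' => by simp [Y, and_comm]
    have hWA := ent_prod_le hP0 hP1 (fun ω => (T2 ω, pre S2 i ω)) (S1 i)
    rw [cmi]
    linarith
  have h_zero : h 0 = ent P T2 := ent_congr P fun ω ω' => by simp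
  have h_last : h n = ent P Y := by
    refine ent_congr P fun ω ω' => ?_
    simp only [Fin.is_lt, if_true, Prod.mk.injEq, funext_iff, Option.some.injEq, hT2]
    exact ⟨fun H => H.2, fun H => ⟨congrArg f (funext H), H⟩⟩
  have ent_Y : ent P Y = ∑ i, ent P (S2 i) := ent_pi_of_iid hP0 hμ1 hiid
  calc _ ≤ ∑ i : Fin n, ((h i - h (i + 1)) + ent P (S2 i)) :=
        Finset.sum_le_sum fun i _ => cmi_le i
    _ = ent P T2 := by
        rw [Finset.sum_add_distrib, Fin.sum_univ_eq_sum_range (fun k => h k - h (k + 1)),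
          Finset.sum_range_sub', h_zero, h_last, ent_Y]
        ring
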